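/- Let −1/2 < κ < 0, l ≥ 1/(1+κ), k₁ > 0 and k₂ > g(l,κ,k₁) be given, where g(l,κ,k₁) := (2l(1+κ)²/((l+1)(1+κ)+κ)) · 2^{(l−1)((l+1)(1+κ)+κ)/(l(1+κ))} · k₁^{1/(1+κ)}. Then the origin 0 ∈ ℝ² is small-time stable for the double integrator system ẋ₁ = x₂, ẋ₂ = u with the feedback law u(x₁,x₂) = −k₂ ⌊⌊x₂⌉^l − ⌊x̄₂⌉^l⌉^{(1+2κ)/(l(1+κ))}, where x̄₂ = x̄₂(x₁) := −k₁ ⌊x₁⌉^{1+κ}. -/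

import Mathlib

open Set Filter

/-- Signed power: `⌊x⌉^a = sign(x) * |x|^a`. -/
noncomputable def spow (x a : ℝ) : ℝ := Real.sign x * |x| ^ a

/-- Dilation `Λ_r(l, x) = (l^{r₁} x₁, …, l^{rₙ} xₙ)`. -/
noncomputable def dil {n : ℕ} (r : Fin n → ℝ) (l : ℝ) (x : Fin n → ℝ) : Fin n → ℝ :=
  fun i => l ^ r i * x i

/-- `x` is a solution of `ẋ = F(x)` on `[s, ∞)`. -/
def IsSolOn {E : Type*} [NormedAddCommGroup E] [NormedSpace ℝ E]
    (F : E → E) (x : ℝ → E) (s : ℝ) : Prop :=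
  ∀ t ∈ Set.Ici s, HasDerivWithinAt x (F (x t)) (Set.Ici s) t

/-- The origin is (locally) asymptotically stable for `ẋ = F(x)`. -/
def AsympStable {E : Type*} [NormedAddCommGroup E] [NormedSpace ℝ E] (F : E → E) : Prop :=
  (∀ ε > 0, ∃ η > 0, ∀ x : ℝ → E, IsSolOn F x 0 → ‖x 0‖ < η → ∀ t ≥ 0, ‖x t‖ < ε) ∧
  (∃ δ > 0, ∀ x : ℝ → E, IsSolOn F x 0 → ‖x 0‖ < δ →
    Filter.Tendsto x Filter.atTop (nhds 0))

/-- The origin is small-time stable for `ẋ = F(x)`. -/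
def SmallTimeStable {E : Type*} [NormedAddCommGroup E] [NormedSpace ℝ E] (F : E → E) : Prop :=
  ∀ ε > 0, ∃ η > 0, ∀ x : ℝ → E, IsSolOn F x 0 → ‖x 0‖ < η →
    x ε = 0 ∧ ∀ t ≥ 0, ‖x t‖ < ε

/-- The gain bound `g(l,κ,k₁)`. -/
noncomputable def gGain (l κ k₁ : ℝ) : ℝ :=
  2*l*(1+κ)^2 / ((l+1)*(1+κ)+κ) *
    2 ^ ((l-1)*((l+1)*(1+κ)+κ) / (l*(1+κ))) * k₁ ^ (1/(1+κ))

lemma spow_zero_left (a : ℝ) : spow 0 a = 0 := by simp [spow]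

lemma spow_of_pos {x : ℝ} (hx : 0 < x) (a : ℝ) : spow x a = x ^ a := by
  simp [spow, Real.sign_of_pos hx, abs_of_pos hx]

lemma spow_neg (x a : ℝ) : spow (-x) a = -spow x a := by
  simp [spow, Real.sign_neg]

lemma spow_eq_max {a : ℝ} (ha : 0 < a) (x : ℝ) : spow x a = max x 0 ^ a - max (-x) 0 ^ a := by
  rcases lt_trichotomy x 0 with h | rfl | h
  · rw [← neg_neg x, spow_neg, spow_of_pos (neg_pos.2 h), neg_neg, max_eq_right h.le,
      max_eq_left (neg_pos.2 h).le, Real.zero_rpow ha.ne', zero_sub]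
  · simp [spow_zero_left]
  · rw [spow_of_pos h, max_eq_left h.le, max_eq_right (neg_neg_of_pos h).le,
      Real.zero_rpow ha.ne', sub_zero]

lemma continuous_spow {a : ℝ} (ha : 0 < a) : Continuous fun x => spow x a := by
  simp only [spow_eq_max ha]
  exact ((continuous_id.max continuous_const).rpow_const fun _ => Or.inr ha.le).sub
    ((continuous_neg.max continuous_const).rpow_const fun _ => Or.inr ha.le)

lemma strictMono_spow {a : ℝ} (ha : 0 < a) : StrictMono fun x => spow x a := by
  intro x y hxy
  simp only [spow_eq_max ha]
  have h₁ : max x 0 ^ a ≤ max y 0 ^ a :=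
    Real.rpow_le_rpow (le_max_right _ _) (max_le_max_right _ hxy.le) ha.le
  have h₂ : max (-y) 0 ^ a ≤ max (-x) 0 ^ a :=
    Real.rpow_le_rpow (le_max_right _ _) (max_le_max_right _ (neg_le_neg hxy.le)) ha.le
  rcases lt_or_ge 0 y with hy | hy
  · have : max x 0 ^ a < max y 0 ^ a :=
      Real.rpow_lt_rpow (le_max_right _ _) (by rw [max_eq_left hy.le]; exact max_lt hxy hy) ha
    linarith
  · have : max (-y) 0 ^ a < max (-x) 0 ^ a := by
      refine Real.rpow_lt_rpow (le_max_right _ _) ?_ ha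
      rw [max_eq_left (by linarith : (0 : ℝ) ≤ -y)]
      exact lt_max_of_lt_left (by linarith)
    linarith

lemma spow_mul_left {c : ℝ} (hc : 0 < c) (x a : ℝ) : spow (c * x) a = c ^ a * spow x a := by
  have : Real.sign (c * x) = Real.sign x := by
    rcases lt_trichotomy x 0 with h | rfl | h
    · rw [Real.sign_of_neg h, Real.sign_of_neg (mul_neg_of_pos_of_neg hc h)]
    · simp
    · rw [Real.sign_of_pos h, Real.sign_of_pos (mul_pos hc h)]
  rw [spow, spow, this, abs_mul, abs_of_pos hc, Real.mul_rpow hc.le (abs_nonneg x)]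
  ring

lemma spow_spow (x a b : ℝ) : spow (spow x a) b = spow x (a * b) := by
  have key : ∀ y : ℝ, 0 < y → spow (spow y a) b = spow y (a * b) := fun y hy => by
    rw [spow_of_pos hy, spow_of_pos (Real.rpow_pos_of_pos hy a), spow_of_pos hy,
      Real.rpow_mul hy.le]
  rcases lt_trichotomy x 0 with h | rfl | h
  · simpa only [spow_neg, neg_inj] using key (-x) (neg_pos.2 h)
  · simp [spow_zero_left]
  · exact key x h

lemma mul_spow_self {a : ℝ} (ha : 0 < a) (x : ℝ) : x * spow x a = |x| ^ (a + 1) := by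
  rcases lt_trichotomy x 0 with h | rfl | h
  · rw [spow, Real.sign_of_neg h, Real.rpow_add_one (abs_pos.2 h.ne).ne', abs_of_neg h]; ring
  · rw [zero_mul, abs_zero, Real.zero_rpow (by linarith)]
  · rw [spow_of_pos h, abs_of_pos h, Real.rpow_add_one h.ne']; ring

lemma hasDerivAt_abs_rpow_spow (x : ℝ) {p : ℝ} (hp : 1 < p) :
    HasDerivAt (fun x : ℝ => |x| ^ p) (p * spow x (p - 1)) x := by
  convert hasDerivAt_abs_rpow x hp using 1
  rcases lt_trichotomy x 0 with h | rfl | h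
  · rw [spow, Real.sign_of_neg h, show p - 1 = p - 2 + 1 by ring,
      Real.rpow_add_one (abs_pos.2 h.ne).ne', abs_of_neg h]; ring
  · simp [spow_zero_left]
  · rw [spow_of_pos h, show p - 1 = p - 2 + 1 by ring, Real.rpow_add_one h.ne', abs_of_pos h]; ring

/-- A nonnegative function with `w' ≤ -c w ^ θ`, `θ < 1`, vanishes after an explicit time. -/
lemma eq_zero_of_deriv_le_neg_rpow {w w' : ℝ → ℝ} {c θ T : ℝ} (hc : 0 < c) (hθ : θ < 1)
    (hT : 0 ≤ T) (hw : ∀ t ∈ Ici (0 : ℝ), HasDerivWithinAt w (w' t) (Ici 0) t)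
    (hnn : ∀ t ∈ Ici (0 : ℝ), 0 ≤ w t) (hle : ∀ t ∈ Ici (0 : ℝ), w' t ≤ -c * w t ^ θ)
    (h0 : w 0 ^ (1 - θ) ≤ c * (1 - θ) * T) : w T = 0 := by
  by_contra hne
  have hpos : 0 < w T := lt_of_le_of_ne (hnn T hT) (Ne.symm hne)
  have hint : ∀ t ∈ interior (Ici (0 : ℝ)), HasDerivAt w (w' t) t := fun t ht => by
    rw [interior_Ici] at ht
    exact (hw t (Ioi_subset_Ici_self ht)).hasDerivAt (Ici_mem_nhds ht)
  have hcont : ContinuousOn w (Ici 0) := fun t ht => (hw t ht).continuousWithinAt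
  have hanti : AntitoneOn w (Ici 0) := by
    refine antitoneOn_of_deriv_nonpos (convex_Ici 0) hcont
      (fun t ht => (hint t ht).differentiableAt.differentiableWithinAt) fun t ht => ?_
    rw [(hint t ht).deriv]
    have ht' := interior_subset ht
    have := mul_nonneg hc.le (Real.rpow_nonneg (hnn t ht') θ)
    linarith [hle t ht']
  have hposI : ∀ t ∈ Icc 0 T, 0 < w t := fun t ht => hpos.trans_le (hanti ht.1 hT ht.2)
  have hder : ∀ t ∈ interior (Icc 0 T),
      HasDerivAt (fun t => w t ^ (1 - θ)) (w' t * (1 - θ) * w t ^ (1 - θ - 1)) t := fun t ht => by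
    have ht' := interior_subset ht
    rw [interior_Icc] at ht
    exact (hint t (by rw [interior_Ici]; exact ht.1)).rpow_const (Or.inl (hposI t ht').ne')
  have hmain := (convex_Icc 0 T).image_sub_le_mul_sub_of_deriv_le
    (f := fun t => w t ^ (1 - θ)) (C := -(c * (1 - θ)))
    ((hcont.mono Icc_subset_Ici_self).rpow_const fun t ht => Or.inl (hposI t ht).ne')
    (fun t ht => (hder t ht).differentiableAt.differentiableWithinAt)
    (fun t ht => by
      rw [(hder t ht).deriv]
      have ht' := interior_subset ht
      have hp := hposI t ht'
      have hq : 0 < w t ^ (1 - θ - 1) := Real.rpow_pos_of_pos hp _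
      have hone : w t ^ θ * w t ^ (1 - θ - 1) = 1 := by
        rw [← Real.rpow_add hp]; ring_nf; exact Real.rpow_zero _
      have h1 := mul_le_mul_of_nonneg_right (hle t ht'.1)
        (mul_nonneg (sub_pos.2 hθ).le hq.le)
      calc w' t * (1 - θ) * w t ^ (1 - θ - 1) = w' t * ((1 - θ) * w t ^ (1 - θ - 1)) := by ring
        _ ≤ -c * w t ^ θ * ((1 - θ) * w t ^ (1 - θ - 1)) := h1
        _ = -(c * (1 - θ)) * (w t ^ θ * w t ^ (1 - θ - 1)) := by ring
        _ = _ := by rw [hone, mul_one])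
    0 (left_mem_Icc.2 hT) T (right_mem_Icc.2 hT) hT
  have : 0 < w T ^ (1 - θ) := Real.rpow_pos_of_pos hpos _
  simp only [sub_zero] at hmain
  linarith

/-- On a compact set, a nonpositive function `A` is made uniformly negative by a small multiple
of a function `B` which is negative wherever `A` vanishes. -/
lemma IsCompact.exists_add_mul_le_neg {X : Type*} [TopologicalSpace X] {K : Set X}
    (hK : IsCompact K) {A B : X → ℝ} (hA : Continuous A) (hB : Continuous B)
    (hA0 : ∀ x ∈ K, A x ≤ 0) (hB0 : ∀ x ∈ K, A x = 0 → B x < 0) :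
    ∃ δ₀ > 0, ∀ δ, 0 < δ → δ ≤ δ₀ → ∃ c > 0, ∀ x ∈ K, A x + δ * B x ≤ -c := by
  have hmin : ∀ {L : Set X} {f : X → ℝ}, IsCompact L → Continuous f → (∀ x ∈ L, f x < 0) →
      ∃ c > 0, ∀ x ∈ L, f x ≤ -c := by
    intro L f hL hf hneg
    rcases L.eq_empty_or_nonempty with rfl | hne
    · exact ⟨1, one_pos, by simp⟩
    · obtain ⟨z, hz, hmax⟩ := hL.exists_isMaxOn hne hf.continuousOn
      exact ⟨-f z, neg_pos.2 (hneg z hz), fun x hx => by simpa using hmax hx⟩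
  have hL : IsCompact (K ∩ {x | 0 ≤ B x}) :=
    hK.inter_right (isClosed_le continuous_const hB)
  obtain ⟨a, ha, hAa⟩ := hmin hL hA fun x hx =>
    lt_of_le_of_ne (hA0 x hx.1) fun h => absurd (hB0 x hx.1 h) (not_lt.2 hx.2)
  obtain ⟨M, hM⟩ := hK.bddAbove_image hB.continuousOn
  have hM1 : 0 < |M| + 1 := by positivity
  refine ⟨a / (2 * (|M| + 1)), by positivity, fun δ hδ hle => ?_⟩
  refine hmin hK (hA.add (continuous_const.mul hB)) fun x hx => ?_
  rcases lt_or_ge (B x) 0 with hb | hb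
  · have := mul_neg_of_pos_of_neg hδ hb
    linarith [hA0 x hx]
  · have hBM : B x ≤ |M| + 1 := by linarith [hM (mem_image_of_mem B hx), le_abs_self M]
    have : δ * B x ≤ a / 2 := by
      calc δ * B x ≤ a / (2 * (|M| + 1)) * (|M| + 1) := by gcongr
        _ = a / 2 := by field_simp
    linarith [hAa x ⟨hx, hb⟩]

/-- Energy of `x'' = -C ⌊x⌉^(2s-1)`. -/
noncomputable def energy (s C : ℝ) (p : ℝ × ℝ) : ℝ := p.2 ^ 2 / 2 + C * (|p.1| ^ (2 * s) / (2 * s))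

lemma continuous_energy {s : ℝ} (hs : 0 < s) (C : ℝ) : Continuous (energy s C) := by
  have : Continuous fun p : ℝ × ℝ => |p.1| ^ (2 * s) :=
    (continuous_fst.abs).rpow_const fun _ => Or.inr (by linarith)
  unfold energy
  fun_prop

lemma energy_nonneg {s C : ℝ} (hs : 0 < s) (hC : 0 < C) (p : ℝ × ℝ) : 0 ≤ energy s C p := by
  unfold energy; positivity

lemma norm_lt_of_energy_lt {s C ε : ℝ} (hs : 0 < s) (hC : 0 < C) (hε : 0 < ε) {p : ℝ × ℝ}
    (hp : energy s C p < min (ε ^ 2 / 2) (C * (ε ^ (2 * s) / (2 * s)))) : ‖p‖ < ε := by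
  have h := lt_min_iff.1 hp
  unfold energy at h
  have h₁ : 0 ≤ C * (|p.1| ^ (2 * s) / (2 * s)) := by positivity
  rw [Prod.norm_def, Real.norm_eq_abs, Real.norm_eq_abs]
  refine max_lt ?_ ?_
  · by_contra! hge
    have : C * (ε ^ (2 * s) / (2 * s)) ≤ C * (|p.1| ^ (2 * s) / (2 * s)) := by gcongr
    nlinarith [h.2, sq_nonneg p.2]
  · exact abs_lt_of_sq_lt_sq (by linarith [h.1]) hε.le

lemma eq_zero_of_energy_eq_zero {s C : ℝ} (hs : 0 < s) (hC : 0 < C) {p : ℝ × ℝ}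
    (hp : energy s C p = 0) : p = 0 := by
  refine norm_le_zero_iff.1 (le_of_forall_pos_lt_add fun ε hε => ?_)
  rw [zero_add]
  refine norm_lt_of_energy_lt hs hC hε (hp ▸ ?_)
  have := Real.rpow_pos_of_pos hε (2 * s)
  exact lt_min (by positivity) (by positivity)

lemma isCompact_energy_eq_one {s C : ℝ} (hs : 0 < s) (hC : 0 < C) :
    IsCompact {p | energy s C p = 1} := by
  refine Metric.isCompact_of_isClosed_isBounded
    (isClosed_eq (continuous_energy hs C) continuous_const) ?_
  have h2s : 0 < 2 * s := by linarith
  have hlim : Tendsto (fun R : ℝ => C * (R ^ (2 * s) / (2 * s))) atTop atTop :=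
    ((tendsto_rpow_atTop h2s).atTop_div_const h2s).const_mul_atTop hC
  obtain ⟨R, hR, hR2⟩ := ((hlim.eventually_gt_atTop 1).and (eventually_ge_atTop 2)).exists
  refine isBounded_iff_forall_norm_le.2 ⟨R, fun p hp => ?_⟩
  refine (norm_lt_of_energy_lt hs hC (by linarith) ?_).le
  rw [mem_ofPred_eq] at hp
  rw [hp]
  exact lt_min (by nlinarith) hR

lemma energy_dilation {s C r : ℝ} (hr : 0 < r) (x y : ℝ) :
    energy s C (r * x, r ^ s * y) = r ^ (2 * s) * energy s C (x, y) := by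
  have h : (r ^ s) ^ 2 = r ^ (2 * s) := by
    rw [← Real.rpow_natCast, ← Real.rpow_mul hr.le]; push_cast; ring_nf
  simp only [energy]
  rw [abs_mul, abs_of_pos hr, Real.mul_rpow hr.le (abs_nonneg x), mul_pow, h]
  ring

/-- Every nonzero point is the dilation of a point of energy one. -/
lemma exists_dilation_energy_eq_one {s C : ℝ} (hs : 0 < s) {p : ℝ × ℝ}
    (hp : 0 < energy s C p) :
    ∃ r > 0, ∃ x y, p = (r * x, r ^ s * y) ∧ energy s C (x, y) = 1 := by
  set e := energy s C p with he
  have hr : 0 < e ^ (1 / (2 * s)) := Real.rpow_pos_of_pos hp _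
  set r := e ^ (1 / (2 * s)) with hrdef
  have hrs : r ^ (2 * s) = e := by
    rw [hrdef, ← Real.rpow_mul hp.le, one_div_mul_cancel (by linarith), Real.rpow_one]
  have hrs' := (Real.rpow_pos_of_pos hr s).ne'
  have hpe : p = (r * (p.1 / r), r ^ s * (p.2 / r ^ s)) := by
    ext <;> simp <;> field_simp
  refine ⟨r, hr, p.1 / r, p.2 / r ^ s, hpe, ?_⟩
  have h := energy_dilation (s := s) (C := C) hr (p.1 / r) (p.2 / r ^ s)
  rw [← hpe, ← he, hrs] at h
  exact mul_left_cancel₀ hp.ne' (by rw [← h, mul_one])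

/-- Existence of a strict homogeneous Lyapunov function `energy ^ m + δ x₁ x₂`. -/
lemma exists_strict_lyapunov {s C : ℝ} (hs : 1 / 2 < s) (hs1 : s < 1) (hC : 0 < C)
    {U : ℝ → ℝ → ℝ} (hU : Continuous fun p : ℝ × ℝ => U p.1 p.2)
    (hanti : ∀ x, StrictAnti (U x)) (hU0 : ∀ x, U x 0 = -C * spow x (2 * s - 1))
    (hhom : ∀ r > 0, ∀ x y, U (r * x) (r ^ s * y) = r ^ (2 * s - 1) * U x y) :
    ∃ δ > 0, ∃ c > 0, ∀ p : ℝ × ℝ,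
      |δ * (p.1 * p.2)| ≤ energy s C p ^ ((1 + s) / (2 * s)) / 2 ∧
      p.2 * (U p.1 p.2 - U p.1 0) * ((1 + s) / (2 * s)) * energy s C p ^ ((1 + s) / (2 * s) - 1)
        + δ * (p.2 * p.2 + p.1 * U p.1 p.2) ≤ -c * energy s C p := by
  have hs0 : 0 < s := by linarith
  set m := (1 + s) / (2 * s) with hm
  have hm1 : 1 < m := by rw [hm, lt_div_iff₀ (by linarith)]; linarith
  have hK := isCompact_energy_eq_one hs0 hC
  have hUx0 : Continuous fun p : ℝ × ℝ => U p.1 0 :=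
    hU.comp (continuous_fst.prodMk continuous_const)
  have hsign : ∀ x y, y ≠ 0 → y * (U x y - U x 0) < 0 := fun x y hy => by
    rcases lt_or_gt_of_ne hy with h | h
    · exact mul_neg_of_neg_of_pos h (sub_pos.2 (hanti x h))
    · exact mul_neg_of_pos_of_neg h (sub_neg.2 (hanti x h))
  obtain ⟨δ₀, hδ₀, hδ⟩ := hK.exists_add_mul_le_neg
    (A := fun p => p.2 * (U p.1 p.2 - U p.1 0) * m) (B := fun p => p.2 * p.2 + p.1 * U p.1 p.2)
    (by fun_prop) (by fun_prop)
    (fun p _ => by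
      refine mul_nonpos_of_nonpos_of_nonneg ?_ (by linarith)
      by_cases h : p.2 = 0
      · simp [h]
      · exact (hsign _ _ h).le)
    (fun p hp h => by
      have h2 : p.2 = 0 := by
        by_contra hne
        exact (mul_neg_of_neg_of_pos (hsign p.1 p.2 hne) (by linarith : 0 < m)).ne h
      have h1 : p.1 ≠ 0 := fun h1 => by
        have : energy s C p = 0 := by
          simp [energy, h1, h2, Real.zero_rpow (by linarith : 2 * s ≠ 0)]
        rw [mem_ofPred_eq, this] at hp
        exact zero_ne_one hp
      have hx := Real.rpow_pos_of_pos (abs_pos.2 h1) (2 * s - 1 + 1)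
      rw [← mul_spow_self (by linarith)] at hx
      simp only [h2, hU0]
      nlinarith [mul_pos hC hx])
  obtain ⟨M, hM⟩ := hK.bddAbove_image
    (f := fun p : ℝ × ℝ => |p.1 * p.2|) (by fun_prop)
  have hM1 : 0 < |M| + 1 := by positivity
  set δ := min δ₀ (1 / (2 * (|M| + 1)))
  have hδpos : 0 < δ := lt_min hδ₀ (by positivity)
  obtain ⟨c, hc, hmain⟩ := hδ δ hδpos (min_le_left _ _)
  refine ⟨δ, hδpos, c, hc, fun p => ?_⟩
  rcases (energy_nonneg hs0 hC p).eq_or_lt with h0 | hpos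
  · have hp := eq_zero_of_energy_eq_zero hs0 hC h0.symm
    rw [← h0, hp]
    simp [Real.zero_rpow (by linarith : m ≠ 0)]
  · obtain ⟨r, hr, x, y, rfl, hxy⟩ := exists_dilation_energy_eq_one hs0 hpos
    have hEm : energy s C (r * x, r ^ s * y) ^ m = r * r ^ s := by
      rw [energy_dilation hr, hxy, mul_one, ← Real.rpow_mul hr.le, hm,
        mul_div_cancel₀ _ (by linarith), Real.rpow_one_add' hr.le (by linarith)]
    have hEm1 : energy s C (r * x, r ^ s * y) ^ (m - 1) = r ^ (1 - s) := by
      rw [energy_dilation hr, hxy, mul_one, ← Real.rpow_mul hr.le, hm]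
      congr 1
      field_simp
      ring
    have hUr0 : U (r * x) 0 = r ^ (2 * s - 1) * U x 0 := by simpa using hhom r hr x 0
    have hpow₁ : r ^ s * r ^ s = r ^ (2 * s) := by rw [← Real.rpow_add hr]; ring_nf
    have hpow₂ : r * r ^ (2 * s - 1) = r ^ (2 * s) := by
      rw [← Real.rpow_one_add' hr.le (by linarith)]; ring_nf
    have hpow₃ : r ^ s * r ^ (2 * s - 1) * r ^ (1 - s) = r ^ (2 * s) := by
      rw [← Real.rpow_add hr, ← Real.rpow_add hr]; ring_nf
    have hR := Real.rpow_pos_of_pos hr s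
    have hR2 := Real.rpow_pos_of_pos hr (2 * s)
    constructor
    · have hb : |x * y| ≤ |M| + 1 := by
        have := hM (mem_image_of_mem (fun p : ℝ × ℝ => |p.1 * p.2|) hxy)
        simp only at this
        linarith [le_abs_self M]
      have hδb : δ * |x * y| ≤ 1 / 2 := by
        calc δ * |x * y| ≤ 1 / (2 * (|M| + 1)) * (|M| + 1) :=
              mul_le_mul (min_le_right _ _) hb (abs_nonneg _) (by positivity)
          _ = 1 / 2 := by field_simp
      rw [hEm]
      calc |δ * (r * x * (r ^ s * y))| = r * r ^ s * (δ * |x * y|) := by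
            rw [show δ * (r * x * (r ^ s * y)) = r * r ^ s * δ * (x * y) by ring, abs_mul,
              abs_of_pos (by positivity)]
            ring
        _ ≤ r * r ^ s * (1 / 2) := by gcongr
        _ = r * r ^ s / 2 := by ring
    · rw [hEm1, energy_dilation hr, hxy]
      simp only [hhom r hr, hUr0]
      have h := mul_le_mul_of_nonneg_left (hmain (x, y) hxy) hR2.le
      simp only at h
      calc _ = r ^ s * r ^ (2 * s - 1) * r ^ (1 - s) * (y * (U x y - U x 0) * m)
            + δ * (r ^ s * r ^ s * (y * y) + r * r ^ (2 * s - 1) * (x * U x y)) := by ring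
        _ = r ^ (2 * s) * (y * (U x y - U x 0) * m + δ * (y * y + x * U x y)) := by
            rw [hpow₁, hpow₂, hpow₃]; ring
        _ ≤ _ := by linarith

/-- A homogeneous damped oscillator `x'' = U(x, x')` of negative degree is small-time stable. -/
theorem smallTimeStable_of_homogeneous {s C : ℝ} (hs : 1 / 2 < s) (hs1 : s < 1) (hC : 0 < C)
    {U : ℝ → ℝ → ℝ} (hU : Continuous fun p : ℝ × ℝ => U p.1 p.2)
    (hanti : ∀ x, StrictAnti (U x)) (hU0 : ∀ x, U x 0 = -C * spow x (2 * s - 1))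
    (hhom : ∀ r > 0, ∀ x y, U (r * x) (r ^ s * y) = r ^ (2 * s - 1) * U x y) :
    SmallTimeStable fun p : ℝ × ℝ => (p.2, U p.1 p.2) := by
  have hs0 : 0 < s := by linarith
  obtain ⟨δ, hδ, c, hc, hL⟩ := exists_strict_lyapunov hs hs1 hC hU hanti hU0 hhom
  set m := (1 + s) / (2 * s) with hm
  have hm1 : 1 < m := by rw [hm, lt_div_iff₀ (by linarith)]; linarith
  have hm0 : 0 < m := by linarith
  have hθ : 1 / m < 1 := by rw [div_lt_one hm0]; exact hm1
  set W : ℝ × ℝ → ℝ := fun p => energy s C p ^ m + δ * (p.1 * p.2) with hW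
  have hE := continuous_energy hs0 C
  have hWc : Continuous W := by
    have : Continuous fun p => energy s C p ^ m := hE.rpow_const fun _ => Or.inr hm0.le
    fun_prop
  have hE0 : energy s C 0 = 0 := by
    simp [energy, Real.zero_rpow (by linarith : 2 * s ≠ 0)]
  have hW0 : W 0 = 0 := by simp [hW, hE0, Real.zero_rpow hm0.ne']
  have hWlow : ∀ p, energy s C p ^ m / 2 ≤ W p := fun p => by
    have := (abs_le.1 (hL p).1).1
    simp only [hW]; linarith
  have hWup : ∀ p, W p ≤ 2 * energy s C p ^ m := fun p => by
    have := (abs_le.1 (hL p).1).2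
    have := Real.rpow_nonneg (energy_nonneg hs0 hC p) m
    simp only [hW]; linarith
  have hWnn : ∀ p, 0 ≤ W p := fun p =>
    (div_nonneg (Real.rpow_nonneg (energy_nonneg hs0 hC p) m) two_pos.le).trans (hWlow p)
  set c' := c / 2 ^ (1 / m) with hc'
  have h2m : (0 : ℝ) < 2 ^ (1 / m) := Real.rpow_pos_of_pos two_pos _
  have hc'0 : 0 < c' := div_pos hc h2m
  have hcW : ∀ p, -c * energy s C p ≤ -c' * W p ^ (1 / m) := fun p => by
    have hen := energy_nonneg hs0 hC p
    have h := Real.rpow_le_rpow (hWnn p) (hWup p) (one_div_pos.2 hm0).le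
    rw [Real.mul_rpow two_pos.le (Real.rpow_nonneg hen m), ← Real.rpow_mul hen,
      mul_one_div_cancel hm0.ne', Real.rpow_one] at h
    have : c' * W p ^ (1 / m) ≤ c * energy s C p := by
      calc c' * W p ^ (1 / m) ≤ c' * (2 ^ (1 / m) * energy s C p) := by gcongr
        _ = c * energy s C p := by rw [hc']; field_simp
    linarith
  intro ε hε
  set e₀ := min (ε ^ 2 / 2) (C * (ε ^ (2 * s) / (2 * s)))
  have he₀pos : 0 < e₀ := by
    have := Real.rpow_pos_of_pos hε (2 * s)
    exact lt_min (by positivity) (by positivity)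
  have hev₁ : ∀ᶠ p in nhds (0 : ℝ × ℝ), energy s C p < e₀ :=
    hE.continuousAt.eventually_lt_const (by rw [hE0]; exact he₀pos)
  have hθ' : 0 < 1 - 1 / m := sub_pos.2 hθ
  have hev₂ : ∀ᶠ p in nhds (0 : ℝ × ℝ), W p ^ (1 - 1 / m) < c' * (1 - 1 / m) * ε :=
    (hWc.rpow_const fun _ => Or.inr hθ'.le).continuousAt.eventually_lt_const
      (by simp only [hW0, Real.zero_rpow hθ'.ne']; positivity)
  obtain ⟨η, hη, hball⟩ := Metric.eventually_nhds_iff.1 (hev₁.and hev₂)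
  refine ⟨η, hη, fun x hx hx0 => ?_⟩
  obtain ⟨hx0E, hx0W⟩ := hball (by rwa [dist_zero_right])
  have hd₁ : ∀ t ∈ Ici (0 : ℝ), HasDerivWithinAt (fun t => (x t).1) (x t).2 (Ici 0) t :=
    fun t ht => (hx t ht).fst
  have hd₂ : ∀ t ∈ Ici (0 : ℝ),
      HasDerivWithinAt (fun t => (x t).2) (U (x t).1 (x t).2) (Ici 0) t :=
    fun t ht => (hx t ht).snd
  have hdE : ∀ t ∈ Ici (0 : ℝ), HasDerivWithinAt (fun t => energy s C (x t))
      ((x t).2 * (U (x t).1 (x t).2 - U (x t).1 0)) (Ici 0) t := fun t ht => by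
    have h₁ := ((((hasDerivAt_abs_rpow_spow (x t).1
      (by linarith : 1 < 2 * s)).comp_hasDerivWithinAt t (hd₁ t ht)).div_const (2 * s)).const_mul C)
    have h₂ := ((hd₂ t ht).pow 2).div_const 2
    refine (h₂.add h₁).congr_deriv ?_
    rw [hU0]
    field_simp
    ring
  have hdW : ∀ t ∈ Ici (0 : ℝ), HasDerivWithinAt (fun t => W (x t)) _ (Ici 0) t := fun t ht =>
    ((hdE t ht).rpow_const (Or.inr hm1.le)).add
      (((hd₁ t ht).mul (hd₂ t ht)).const_mul δ)
  constructor
  · have hz := eq_zero_of_deriv_le_neg_rpow hc'0 hθ hε.le hdW (fun t _ => hWnn _)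
      (fun t _ => (hL (x t)).2.trans (hcW _)) hx0W.le
    have hle := hWlow (x ε)
    rw [hz] at hle
    refine eq_zero_of_energy_eq_zero hs0 hC
      ((Real.rpow_eq_zero (energy_nonneg hs0 hC _) hm0.ne').1 ?_)
    exact le_antisymm (by linarith) (Real.rpow_nonneg (energy_nonneg hs0 hC _) m)
  · intro t ht
    refine norm_lt_of_energy_lt hs0 hC hε (lt_of_le_of_lt ?_ hx0E)
    have hmono : AntitoneOn (fun t => energy s C (x t)) (Ici 0) := by
      refine antitoneOn_of_hasDerivWithinAt_nonpos (convex_Ici 0)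
        (fun t ht => (hdE t ht).continuousWithinAt)
        (fun t ht => (hdE t (interior_subset ht)).mono interior_subset) fun t _ => ?_
      rcases le_total (x t).2 0 with h | h
      · exact mul_nonpos_of_nonpos_of_nonneg h (sub_nonneg.2 ((hanti _).antitone h))
      · exact mul_nonpos_of_nonneg_of_nonpos h (sub_nonpos.2 ((hanti _).antitone h))
    exact hmono self_mem_Ici ht ht

lemma gGain_pos {l κ k₁ : ℝ} (hκ : -(1/2) < κ) (hl : 0 < l) (hk₁ : 0 < k₁) :
    0 < gGain l κ k₁ := by
  have h1 : 0 < 1 + κ := by linarith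
  have h2 : 0 < (l + 1) * (1 + κ) + κ := by nlinarith [mul_pos hl h1]
  unfold gGain
  positivity

/-- Small-time stabilization of the double integrator by backstepping:
`u = -k₂⌊⌊x₂⌉^l - ⌊x̄₂⌉^l⌉^{(1+2κ)/(l(1+κ))}` with `x̄₂ = -k₁⌊x₁⌉^{1+κ}`. -/
theorem stmt8 (κ l k₁ k₂ : ℝ) (hκ₁ : -(1/2) < κ) (hκ₂ : κ < 0)
    (hl : 1/(1+κ) ≤ l) (hk₁ : 0 < k₁) (hk₂ : gGain l κ k₁ < k₂) :
    SmallTimeStable (fun p : ℝ × ℝ =>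
      (p.2, -k₂ * spow (spow p.2 l - spow (-k₁ * spow p.1 (1+κ)) l)
        ((1 + 2*κ) / (l * (1+κ))))) := by
  have hs0 : 0 < 1 + κ := by linarith
  have hl0 : 0 < l := (one_div_pos.2 hs0).trans_le hl
  have hk₂0 : 0 < k₂ := (gGain_pos hκ₁ hl0 hk₁).trans hk₂
  set β := (1 + 2*κ) / (l * (1+κ)) with hβ
  have hβ0 : 0 < β := div_pos (by linarith) (by positivity)
  have hlβ : (1 + κ) * l * β = 2 * (1 + κ) - 1 := by rw [hβ]; field_simp; ring
  have hbar : ∀ x, spow (-k₁ * spow x (1+κ)) l = -(k₁ ^ l * spow x ((1 + κ) * l)) := fun x => by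
    rw [neg_mul, spow_neg, spow_mul_left hk₁, spow_spow]
  have hk₁l := Real.rpow_pos_of_pos hk₁ l
  refine smallTimeStable_of_homogeneous (s := 1 + κ) (C := k₂ * (k₁ ^ l) ^ β)
    (U := fun x y => -k₂ * spow (spow y l - spow (-k₁ * spow x (1+κ)) l) β)
    (by linarith) (by linarith) (by positivity) ?_ ?_ ?_ ?_
  · have h₁ := continuous_spow hl0
    have h₂ := continuous_spow hβ0
    have h₃ := continuous_spow hs0
    fun_prop
  · intro x y z hyz
    have h := strictMono_spow hβ0
      (sub_lt_sub_right (strictMono_spow hl0 hyz) (spow (-k₁ * spow x (1+κ)) l))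
    simp only at h ⊢
    nlinarith
  · intro x
    rw [hbar, spow_zero_left, zero_sub, neg_neg, spow_mul_left hk₁l, spow_spow, hlβ]
    ring
  · intro r hr x y
    have hrs := Real.rpow_pos_of_pos hr ((1 + κ) * l)
    rw [hbar, hbar, spow_mul_left hr, spow_mul_left (Real.rpow_pos_of_pos hr _),
      ← Real.rpow_mul hr.le, ← hlβ, Real.rpow_mul hr.le _ β]
    rw [show r ^ ((1 + κ) * l) * spow y l - -(k₁ ^ l * (r ^ ((1 + κ) * l) * spow x ((1 + κ) * l)))
      = r ^ ((1 + κ) * l) * (spow y l - -(k₁ ^ l * spow x ((1 + κ) * l))) by ring,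
      spow_mul_left hrs]
    ring
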